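/- There exists a cyclic code C ⊆ G_2(9,3) with minimum subspace distance at least 4 and |C| = 5694, consisting of 11 orbits of cardinality 511 and one orbit of cardinality 73; consequently 𝒞_2(9,4,3) ≥ 5694. Moreover, there is no nonempty cyclic code in G_2(9,2) with minimum subspace distance at least 4, i.e., 𝒞_2(9,4,2) = 0. -/

import Mathlib

open Module

/-- The cyclic shift `αV = {αv : v ∈ V}` of an `Fq`-subspace `V` of the extension field `F`
by a field element `α`. -/
def cyclicShift (Fq F : Type*) [Field Fq] [Field F] [Algebra Fq F]
    (α : F) (V : Submodule Fq F) : Submodule Fq F :=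
  Submodule.map (LinearMap.mulLeft Fq α) V

/-- The subspace distance `d(U,W) = dim U + dim W − 2 dim (U ∩ W)`. -/
noncomputable def subspaceDist (Fq F : Type*) [Field Fq] [Field F] [Algebra Fq F]
    (U W : Submodule Fq F) : ℕ :=
  finrank Fq U + finrank Fq W - 2 * finrank Fq ↥(U ⊓ W)

/-- `C` is a cyclic code in the Grassmannian `G_q(n,k)` (all members have dimension `k`,
and `C` is closed under cyclic shifts by nonzero field elements) with minimum subspace
distance at least `d`. -/
def IsCyclicCode (Fq F : Type*) [Field Fq] [Field F] [Algebra Fq F]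
    (k d : ℕ) (C : Set (Submodule Fq F)) : Prop :=
  (∀ U ∈ C, finrank Fq U = k) ∧
  (∀ α : F, α ≠ 0 → ∀ U ∈ C, cyclicShift Fq F α U ∈ C) ∧
  (∀ U ∈ C, ∀ W ∈ C, U ≠ W → d ≤ subspaceDist Fq F U W)

/-- The orbit `orb(V) = {αV : α ∈ F, α ≠ 0}` of a subspace `V`. -/
def orbitOf (Fq F : Type*) [Field Fq] [Field F] [Algebra Fq F]
    (V : Submodule Fq F) : Set (Submodule Fq F) :=
  {W | ∃ α : F, α ≠ 0 ∧ W = cyclicShift Fq F α V}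

/-- The set of orbits of members of a code `C`. -/
def orbitsOf (Fq F : Type*) [Field Fq] [Field F] [Algebra Fq F]
    (C : Set (Submodule Fq F)) : Set (Set (Submodule Fq F)) :=
  {O | ∃ V ∈ C, O = orbitOf Fq F V}

/-- Multiplication by `X` modulo `X ^ 9 + X ^ 4 + 1` of a binary polynomial of degree less than `9`,
encoded by the bits of a natural number. -/
def mulX (v : ℕ) : ℕ := if v.testBit 8 then (2 * v) ^^^ 529 else 2 * v

/-- The bits of `X ^ n` modulo `X ^ 9 + X ^ 4 + 1`. -/
def expBits : ℕ → ℕ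
  | 0 => 1
  | n + 1 => mulX (expBits n)

/-- The exponents of the nonzero elements of representatives of the twelve orbits. The last block
is the one of the subfield `𝔽₈`. -/
def blocks : Fin 12 → List ℕ :=
  ![[0, 2, 195, 260, 401, 444, 451], [0, 4, 9, 115, 459, 484, 500],
    [0, 14, 102, 134, 174, 197, 397], [0, 21, 143, 189, 306, 355, 425],
    [0, 3, 42, 101, 217, 241, 420], [0, 1, 38, 130, 331, 364, 376],
    [0, 8, 18, 93, 304, 357, 453], [0, 17, 97, 186, 254, 341, 464],
    [0, 6, 90, 109, 164, 208, 329], [0, 26, 105, 139, 276, 333, 384],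
    [0, 29, 83, 161, 242, 313, 463], [0, 73, 146, 219, 292, 365, 438]]

lemma mulX_lt : ∀ v < 512, mulX v < 512 := by decide +kernel

lemma expBits_lt (n : ℕ) : expBits n < 512 := by
  induction n with
  | zero => decide
  | succ n ih => exact mulX_lt _ ih

lemma blocks_card : ∀ j, (blocks j).toFinset.card = 7 := by decide +kernel

lemma blocks_closed : ∀ j, ∀ a ∈ blocks j, ∀ b ∈ blocks j, a ≠ b →
    ∃ c ∈ blocks j, expBits a ^^^ expBits b = expBits c := by decide +kernel

/-- The set of differences `a - b` modulo `511`, for `b ≠ a` in `l`, encoded as a bit mask. -/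
def shiftMask (l : List ℕ) (a : ℕ) : ℕ :=
  l.foldr (fun b m => if a = b then m else m ||| 2 ^ ((a + 511 - b) % 511)) 0

lemma testBit_shiftMask {l : List ℕ} {a b : ℕ} (hb : b ∈ l) (hab : a ≠ b) :
    (shiftMask l a).testBit ((a + 511 - b) % 511) = true := by
  induction l with
  | nil => simp at hb
  | cons x l ih =>
    have hc : shiftMask (x :: l) a = if a = x then shiftMask l a
      else shiftMask l a ||| 2 ^ ((a + 511 - x) % 511) := rfl
    rw [hc]
    rcases List.mem_cons.1 hb with rfl | h
    · simp [hab, Nat.testBit_or]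
    · split_ifs <;> simp [Nat.testBit_or, ih h]

lemma shiftMask_disjoint : ∀ j, ∀ a ∈ blocks j, ∀ k, ∀ c ∈ blocks k,
    shiftMask (blocks j) a &&& shiftMask (blocks k) c = 0 ∨ (j = k ∧ (a = c ∨ j = 11)) := by
  decide +kernel

lemma blocks_lt : ∀ j, ∀ a ∈ blocks j, a < 511 := by decide +kernel

lemma blocks_sep {j k : Fin 12} {a b c d : ℕ} (ha : a ∈ blocks j) (hb : b ∈ blocks j)
    (hab : a ≠ b) (hc : c ∈ blocks k) (hd : d ∈ blocks k) (hcd : c ≠ d)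
    (h : (a + d) % 511 = (c + b) % 511) : j = k ∧ (a = c ∨ j = 11) := by
  refine (shiftMask_disjoint j a ha k c hc).resolve_left fun h0 => ?_
  have h1 := testBit_shiftMask hb hab
  have h2 := testBit_shiftMask hd hcd
  have hb' := blocks_lt j b hb
  have hd' := blocks_lt k d hd
  rw [show (c + 511 - d) % 511 = (a + 511 - b) % 511 by omega] at h2
  have := congrArg (Nat.testBit · ((a + 511 - b) % 511)) h0
  simp [Nat.testBit_and, h1, h2] at this

lemma mem_blocks_last {a : ℕ} : a ∈ blocks 11 ↔ a % 73 = 0 ∧ a < 511 := by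
  have h : ∀ a ∈ blocks 11, a % 73 = 0 := by decide +kernel
  have h' : ∀ m < 7, 73 * m ∈ blocks 11 := by decide +kernel
  refine ⟨fun ha => ⟨h a ha, blocks_lt 11 a ha⟩, fun ⟨h0, h1⟩ => ?_⟩
  rw [← Nat.mul_div_cancel' (Nat.dvd_of_mod_eq_zero h0)]
  exact h' _ (by omega)

/-- The value at `γ` of the binary polynomial whose coefficients are the bits of `v < 2 ^ 10`. -/
def evalBits {R : Type*} [CommRing R] (γ : R) (v : ℕ) : R :=
  ∑ i ∈ Finset.range 10, if v.testBit i then γ ^ i else 0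

lemma evalBits_xor {R : Type*} [CommRing R] [CharP R 2] (γ : R) (v w : ℕ) :
    evalBits γ (v ^^^ w) = evalBits γ v + evalBits γ w := by
  unfold evalBits
  rw [← Finset.sum_add_distrib]
  refine Finset.sum_congr rfl fun i _ => ?_
  rw [Nat.testBit_xor]
  cases v.testBit i <;> cases w.testBit i <;> simp [CharTwo.add_self_eq_zero]

lemma evalBits_two_mul {R : Type*} [CommRing R] (γ : R) {v : ℕ} (hv : v < 512) :
    evalBits γ (2 * v) = γ * evalBits γ v := by
  unfold evalBits
  rw [Finset.sum_range_succ', Finset.sum_range_succ _ 9, Nat.testBit_lt_two_pow (i := 9) hv]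
  simp [Finset.mul_sum, pow_succ', Nat.testBit_succ]

lemma evalBits_mulX {R : Type*} [CommRing R] [CharP R 2] {γ : R}
    (hγ : γ ^ 9 + γ ^ 4 + 1 = 0) {v : ℕ} (hv : v < 512) :
    evalBits γ (mulX v) = γ * evalBits γ v := by
  have h : evalBits γ 529 = 0 := by
    rw [← hγ]
    simp [evalBits, Finset.sum_range_succ, Nat.testBit, Nat.shiftRight_eq_div_pow]
    ring
  unfold mulX
  split_ifs
  · rw [evalBits_xor, h, add_zero, evalBits_two_mul γ hv]
  · exact evalBits_two_mul γ hv

lemma pow_eq_evalBits {R : Type*} [CommRing R] [CharP R 2] {γ : R}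
    (hγ : γ ^ 9 + γ ^ 4 + 1 = 0) (n : ℕ) : γ ^ n = evalBits γ (expBits n) := by
  induction n with
  | zero => simp [expBits, evalBits, Finset.sum_range_succ, Nat.testBit, Nat.shiftRight_eq_div_pow]
  | succ n ih => rw [pow_succ', ih, expBits, evalBits_mulX hγ (expBits_lt n)]

lemma pow_add_pow_of_xor {R : Type*} [CommRing R] [CharP R 2] {γ : R}
    (hγ : γ ^ 9 + γ ^ 4 + 1 = 0) {a b c : ℕ} (h : expBits a ^^^ expBits b = expBits c) :
    γ ^ a + γ ^ b = γ ^ c := by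
  simp only [pow_eq_evalBits hγ, ← evalBits_xor, h]

lemma root_pow_511 {R : Type*} [CommRing R] [CharP R 2] {γ : R}
    (hγ : γ ^ 9 + γ ^ 4 + 1 = 0) : γ ^ 511 = 1 := by
  have h : expBits 511 = expBits 0 := by decide +kernel
  rw [pow_eq_evalBits hγ, h, ← pow_eq_evalBits hγ, pow_zero]

lemma orderOf_root {R : Type*} [CommRing R] [CharP R 2] {γ : R}
    (hγ : γ ^ 9 + γ ^ 4 + 1 = 0) [Nontrivial R] : orderOf γ = 511 := by
  have key (m e : ℕ) (h : expBits (e + m) ^^^ expBits e = expBits 0) : γ ^ m ≠ 1 := fun h1 => by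
    have := pow_add_pow_of_xor hγ h
    rw [pow_add, h1, mul_one, CharTwo.add_self_eq_zero, pow_zero] at this
    exact zero_ne_one this
  refine orderOf_eq_of_pow_and_pow_div_prime (by norm_num) (root_pow_511 hγ) fun p hp hd => ?_
  rw [show 511 = 7 * 73 by norm_num, hp.dvd_mul, Nat.prime_dvd_prime_iff_eq hp (by norm_num),
    Nat.prime_dvd_prime_iff_eq hp (by norm_num)] at hd
  rcases hd with rfl | rfl
  · exact key 73 292 (by decide +kernel)
  · exact key 7 444 (by decide +kernel)

open Polynomial in
lemma exists_root : ∃ γ : GaloisField 2 9, γ ^ 9 + γ ^ 4 + 1 = 0 := by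
  let f : (ZMod 2)[X] := X ^ 9 + X ^ 4 + 1
  have hdeg : f.degree = 9 := by simp only [f]; compute_degree!
  have : Nontrivial (AdjoinRoot f) := AdjoinRoot.nontrivial f (by rw [hdeg]; norm_num)
  have : CharP (AdjoinRoot f) 2 := charP_of_injective_algebraMap
    (algebraMap (ZMod 2) (AdjoinRoot f)).injective 2
  have hroot : (AdjoinRoot.root f) ^ 9 + (AdjoinRoot.root f) ^ 4 + 1 = 0 := by
    simpa only [f, eval₂_add, eval₂_pow, eval₂_X, eval₂_one] using AdjoinRoot.eval₂_root f
  have hdvd : f ∣ X ^ 2 ^ 9 - X := by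
    rw [← AdjoinRoot.mk_eq_zero]
    have h := root_pow_511 hroot
    simp only [map_sub, map_pow, AdjoinRoot.mk_X]
    rw [show 2 ^ 9 = 511 + 1 by norm_num, pow_succ, h, one_mul, sub_self]
  have hne : (X ^ 2 ^ 9 - X : (ZMod 2)[X]) ≠ 0 :=
    FiniteField.X_pow_card_pow_sub_X_ne_zero _ (by norm_num) (by norm_num)
  have hs : ((X ^ 2 ^ 9 - X : (ZMod 2)[X]).map (algebraMap (ZMod 2) (GaloisField 2 9))).Splits :=
    SplittingField.splits _
  have hf : (f.map (algebraMap (ZMod 2) (GaloisField 2 9))).Splits :=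
    hs.of_dvd ((Polynomial.map_ne_zero_iff (algebraMap (ZMod 2) (GaloisField 2 9)).injective).2 hne)
      (Polynomial.map_dvd _ hdvd)
  obtain ⟨a, ha⟩ := hf.exists_eval_eq_zero (by rw [degree_map, hdeg]; norm_num)
  exact ⟨a, by
    simpa only [f, Polynomial.map_add, Polynomial.map_pow, map_X, Polynomial.map_one, eval_add,
      eval_pow, eval_X, eval_one] using ha⟩

section Shift

variable {Fq F : Type*} [Field Fq] [Field F] [Algebra Fq F]

lemma mem_cyclicShift {α x : F} {V : Submodule Fq F} :
    x ∈ cyclicShift Fq F α V ↔ ∃ v ∈ V, α * v = x := by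
  simp [cyclicShift]

lemma cyclicShift_one (V : Submodule Fq F) : cyclicShift Fq F 1 V = V := by
  ext; simp [mem_cyclicShift]

lemma cyclicShift_mul (α β : F) (V : Submodule Fq F) :
    cyclicShift Fq F (α * β) V = cyclicShift Fq F α (cyclicShift Fq F β V) := by
  ext; simp [mem_cyclicShift, mul_assoc]

lemma finrank_cyclicShift {α : F} (hα : α ≠ 0) (V : Submodule Fq F) :
    finrank Fq (cyclicShift Fq F α V) = finrank Fq V :=
  (Submodule.equivMapOfInjective (LinearMap.mulLeft Fq α) (mul_right_injective₀ hα)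
    V).finrank_eq.symm

lemma mem_orbitOf_self (V : Submodule Fq F) : V ∈ orbitOf Fq F V :=
  ⟨1, one_ne_zero, (cyclicShift_one V).symm⟩

lemma orbitOf_cyclicShift {α : F} (hα : α ≠ 0) (V : Submodule Fq F) :
    orbitOf Fq F (cyclicShift Fq F α V) = orbitOf Fq F V := by
  ext W
  constructor
  · rintro ⟨β, hβ, rfl⟩
    exact ⟨β * α, mul_ne_zero hβ hα, (cyclicShift_mul _ _ _).symm⟩
  · rintro ⟨β, hβ, rfl⟩
    exact ⟨β / α, div_ne_zero hβ hα, by rw [← cyclicShift_mul, div_mul_cancel₀ _ hα]⟩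

lemma exists_pair_of_two_le_finrank {V : Submodule Fq F} (h : 2 ≤ finrank Fq V) :
    ∃ x ∈ V, ∃ y ∈ V, x ≠ 0 ∧ y ≠ 0 ∧ x ≠ y := by
  have : Nontrivial V := Module.nontrivial_of_finrank_pos (R := Fq) (by omega)
  obtain ⟨x, hx⟩ := exists_ne (0 : V)
  obtain ⟨y, hy⟩ := exists_linearIndependent_pair_of_one_lt_finrank (R := Fq) (M := V)
    (by omega) hx
  have h0 := hy.ne_zero 1
  have h1 := hy.injective.ne (show (0 : Fin 2) ≠ 1 by decide)
  simp only [Matrix.cons_val_zero, Matrix.cons_val_one] at h0 h1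
  exact ⟨x, x.2, y, y.2, by simpa using hx, by simpa using h0, fun h => h1 (Subtype.ext h)⟩

end Shift

section Planes

lemma ncard_ne_zero_of_card {F : Type*} [Field F] [Finite F] (hF : Nat.card F = 512) :
    {x : F | x ≠ 0}.ncard = 511 := by
  have := Set.ncard_add_ncard_compl ({0} : Set F)
  rw [Set.ncard_singleton, hF] at this
  change ({0}ᶜ : Set F).ncard = 511
  omega

lemma root_ne_zero {F : Type*} [Field F] {γ : F} (hγ : γ ^ 9 + γ ^ 4 + 1 = 0) : γ ≠ 0 := by
  rintro rfl
  simp at hγ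

variable {F : Type*} [Field F] [CharP F 2]

lemma mod_eq_of_root_pow_eq {γ : F} (hγ : γ ^ 9 + γ ^ 4 + 1 = 0) {m n : ℕ} (h : γ ^ m = γ ^ n) :
    m % 511 = n % 511 := by
  have h' : Units.mk0 γ (root_ne_zero hγ) ^ m = Units.mk0 γ (root_ne_zero hγ) ^ n :=
    Units.ext (by simpa using h)
  rwa [pow_inj_mod, ← orderOf_units, Units.val_mk0, orderOf_root hγ] at h'

lemma root_pow_mod {γ : F} (hγ : γ ^ 9 + γ ^ 4 + 1 = 0) (n : ℕ) : γ ^ (n % 511) = γ ^ n := by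
  conv_rhs => rw [← Nat.mod_add_div n 511, pow_add, pow_mul, root_pow_511 hγ, one_pow, mul_one]

lemma exists_root_pow_eq [Finite F] {γ : F} (hγ : γ ^ 9 + γ ^ 4 + 1 = 0)
    (hF : Nat.card F = 512) {x : F} (hx : x ≠ 0) :
    ∃ n : ℕ, γ ^ n = x := by
  have h : (γ ^ · : ℕ → F) '' Set.Iio 511 = {x : F | x ≠ 0} := by
    refine Set.eq_of_subset_of_ncard_le ?_ ?_
    · rintro _ ⟨n, -, rfl⟩
      exact pow_ne_zero n (root_ne_zero hγ)
    · rw [ncard_ne_zero_of_card hF, Set.InjOn.ncard_image]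
      · simp [← Finset.coe_Iio, Set.ncard_coe_finset]
      · intro m hm n hn hmn
        have := mod_eq_of_root_pow_eq hγ hmn
        simp only [Set.mem_Iio] at hm hn
        omega
  obtain ⟨n, -, hn⟩ := h.ge hx
  exact ⟨n, hn⟩

variable [Algebra (ZMod 2) F]

/-- The `𝔽₂`-subspace whose nonzero elements are the powers of `γ` with exponents in a block. -/
def plane {γ : F} (hγ : γ ^ 9 + γ ^ 4 + 1 = 0) (j : Fin 12) : Submodule (ZMod 2) F where
  carrier := {x | x = 0 ∨ ∃ a ∈ blocks j, γ ^ a = x}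
  zero_mem' := Or.inl rfl
  add_mem' := by
    rintro x y (rfl | ⟨a, ha, rfl⟩) hy
    · simpa using hy
    · rcases hy with rfl | ⟨b, hb, rfl⟩
      · exact Or.inr ⟨a, ha, by simp⟩
      · by_cases hab : a = b
        · exact Or.inl (by rw [hab, CharTwo.add_self_eq_zero])
        · obtain ⟨c, hc, h⟩ := blocks_closed j a ha b hb hab
          exact Or.inr ⟨c, hc, (pow_add_pow_of_xor hγ h).symm⟩
  smul_mem' c x hx := by
    fin_cases c
    · exact Or.inl (zero_smul _ x)
    · exact (one_smul (ZMod 2) x).symm ▸ hx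

variable {γ : F} (hγ : γ ^ 9 + γ ^ 4 + 1 = 0)

lemma mem_plane {j : Fin 12} {x : F} : x ∈ plane hγ j ↔ x = 0 ∨ ∃ a ∈ blocks j, γ ^ a = x :=
  Iff.rfl

lemma finrank_plane [Finite F] (j : Fin 12) : finrank (ZMod 2) (plane hγ j) = 3 := by
  classical
  have hcarrier : (plane hγ j : Set F) =
      ↑(insert 0 ((blocks j).toFinset.image (γ ^ ·)) : Finset F) := by
    ext x
    simp [mem_plane]
  have hinj : Set.InjOn (γ ^ · : ℕ → F) ((blocks j).toFinset : Set ℕ) := by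
    intro a ha b hb hab
    have := mod_eq_of_root_pow_eq hγ hab
    have ha' := blocks_lt j a (by simpa using ha)
    have hb' := blocks_lt j b (by simpa using hb)
    omega
  have hcard : Nat.card (plane hγ j) = 8 := by
    change Nat.card (plane hγ j : Set F) = 8
    rw [hcarrier, Nat.card_coe_set_eq, Set.ncard_coe_finset, Finset.card_insert_of_notMem,
      Finset.card_image_of_injOn hinj]
    · exact congrArg (· + 1) (blocks_card j)
    · simp [root_ne_zero hγ]
  rw [Module.natCard_eq_pow_finrank (K := ZMod 2), Nat.card_zmod] at hcard
  exact Nat.pow_right_injective le_rfl (hcard.trans (by norm_num : 8 = 2 ^ 3))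

lemma cyclicShift_root_pow_last [Finite F] {n : ℕ} (hn : n % 73 = 0) :
    cyclicShift (ZMod 2) F (γ ^ n) (plane hγ 11) = plane hγ 11 := by
  refine Submodule.eq_of_le_of_finrank_eq ?_
    (finrank_cyclicShift (pow_ne_zero _ (root_ne_zero hγ)) _)
  rintro _ hx
  obtain ⟨v, hv, rfl⟩ := mem_cyclicShift.1 hx
  rcases hv with rfl | ⟨a, ha, rfl⟩
  · simp
  · rw [mem_blocks_last] at ha
    exact Or.inr ⟨(n + a) % 511, mem_blocks_last.2 (by omega), by
      rw [root_pow_mod hγ, pow_add]⟩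

lemma eq_of_mem_cyclicShift_plane [Finite F] {j k : Fin 12} {α β : F} (hα : α ≠ 0) (hβ : β ≠ 0)
    {x y : F} (hx : x ≠ 0) (hy : y ≠ 0) (hxy : x ≠ y)
    (hxj : x ∈ cyclicShift (ZMod 2) F α (plane hγ j))
    (hyj : y ∈ cyclicShift (ZMod 2) F α (plane hγ j))
    (hxk : x ∈ cyclicShift (ZMod 2) F β (plane hγ k))
    (hyk : y ∈ cyclicShift (ZMod 2) F β (plane hγ k)) :
    j = k ∧ (α = β ∨ j = 11) ∧
      cyclicShift (ZMod 2) F α (plane hγ j) = cyclicShift (ZMod 2) F β (plane hγ k) := by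
  have hγ0 := root_ne_zero hγ
  have aux {i : Fin 12} {δ z : F} (hz : z ≠ 0) (h : z ∈ cyclicShift (ZMod 2) F δ (plane hγ i)) :
      ∃ a ∈ blocks i, δ * γ ^ a = z := by
    obtain ⟨v, rfl | ⟨a, ha, rfl⟩, rfl⟩ := mem_cyclicShift.1 h
    · simp at hz
    · exact ⟨a, ha, rfl⟩
  obtain ⟨a, ha, hax⟩ := aux hx hxj
  obtain ⟨b, hb, hby⟩ := aux hy hyj
  obtain ⟨c, hc, hcx⟩ := aux hx hxk
  obtain ⟨d, hd, hdy⟩ := aux hy hyk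
  have hab : a ≠ b := by rintro rfl; exact hxy (hax.symm.trans hby)
  have hcd : c ≠ d := by rintro rfl; exact hxy (hcx.symm.trans hdy)
  have hpow : γ ^ (a + d) = γ ^ (c + b) := by
    refine mul_left_cancel₀ (mul_ne_zero hα hβ) ?_
    calc α * β * γ ^ (a + d) = α * γ ^ a * (β * γ ^ d) := by ring
      _ = β * γ ^ c * (α * γ ^ b) := by rw [hax, hdy, hcx, hby]
      _ = α * β * γ ^ (c + b) := by ring
  obtain ⟨rfl, h⟩ := blocks_sep ha hb hab hc hd hcd (mod_eq_of_root_pow_eq hγ hpow)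
  refine ⟨rfl, ?_⟩
  rcases h with rfl | rfl
  · have : α = β := mul_right_cancel₀ (pow_ne_zero a hγ0) (hax.trans hcx.symm)
    exact ⟨Or.inl this, by rw [this]⟩
  · refine ⟨Or.inr rfl, ?_⟩
    rw [← cyclicShift_root_pow_last hγ (mem_blocks_last.1 ha).1, ← cyclicShift_mul, hax, ← hcx,
      cyclicShift_mul, cyclicShift_root_pow_last hγ (mem_blocks_last.1 hc).1,
      cyclicShift_root_pow_last hγ (mem_blocks_last.1 ha).1]

lemma eq_of_cyclicShift_plane_eq [Finite F] {j k : Fin 12} {α β : F} (hα : α ≠ 0) (hβ : β ≠ 0)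
    (h : cyclicShift (ZMod 2) F α (plane hγ j) = cyclicShift (ZMod 2) F β (plane hγ k)) :
    j = k ∧ (α = β ∨ j = 11) := by
  obtain ⟨x, hx, y, hy, hx0, hy0, hxy⟩ := exists_pair_of_two_le_finrank
    (V := cyclicShift (ZMod 2) F α (plane hγ j))
    (by rw [finrank_cyclicShift hα, finrank_plane]; norm_num)
  have := eq_of_mem_cyclicShift_plane hγ hα hβ hx0 hy0 hxy hx hy (h ▸ hx) (h ▸ hy)
  exact ⟨this.1, this.2.1⟩

lemma ncard_orbitOf_plane [Finite F] (hF : Nat.card F = 512) {j : Fin 12} (hj : j ≠ 11) :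
    (orbitOf (ZMod 2) F (plane hγ j)).ncard = 511 := by
  have h : orbitOf (ZMod 2) F (plane hγ j) =
      (fun α => cyclicShift (ZMod 2) F α (plane hγ j)) '' {α : F | α ≠ 0} := by
    ext W
    simp [orbitOf, eq_comm]
  rw [h, Set.InjOn.ncard_image, ncard_ne_zero_of_card hF]
  exact fun α hα β hβ hαβ => (eq_of_cyclicShift_plane_eq hγ hα hβ hαβ).2.resolve_right hj

lemma ncard_orbitOf_plane_last [Finite F] (hF : Nat.card F = 512) :
    (orbitOf (ZMod 2) F (plane hγ 11)).ncard = 73 := by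
  have h : orbitOf (ZMod 2) F (plane hγ 11) =
      (fun n => cyclicShift (ZMod 2) F (γ ^ n) (plane hγ 11)) '' (Finset.range 73 : Set ℕ) := by
    ext W
    constructor
    · rintro ⟨α, hα, rfl⟩
      obtain ⟨n, rfl⟩ := exists_root_pow_eq hγ hF hα
      refine ⟨n % 73, by simpa using Nat.mod_lt n (by norm_num), ?_⟩
      conv_rhs => rw [← Nat.mod_add_div n 73, pow_add, cyclicShift_mul,
        cyclicShift_root_pow_last hγ (Nat.mul_mod_right 73 _)]
    · rintro ⟨n, -, rfl⟩
      exact ⟨γ ^ n, pow_ne_zero n (root_ne_zero hγ), rfl⟩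
  rw [h, Set.InjOn.ncard_image, Set.ncard_coe_finset, Finset.card_range]
  intro m hm n hn hmn
  have h1 : γ ^ m ∈ cyclicShift (ZMod 2) F (γ ^ m) (plane hγ 11) :=
    mem_cyclicShift.2 ⟨1, Or.inr ⟨0, mem_blocks_last.2 (by norm_num), pow_zero γ⟩, mul_one _⟩
  simp only at hmn
  rw [hmn] at h1
  obtain ⟨v, hv, hvm⟩ := mem_cyclicShift.1 h1
  rcases hv with rfl | ⟨a, ha, rfl⟩
  · exact absurd hvm.symm (by simp [root_ne_zero hγ])
  · rw [← pow_add] at hvm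
    have := mod_eq_of_root_pow_eq hγ hvm
    rw [mem_blocks_last] at ha
    simp only [Finset.coe_range, Set.mem_Iio] at hm hn
    omega

/-- The union of the orbits of all planes. -/
def planeCode : Set (Submodule (ZMod 2) F) := ⋃ j, orbitOf (ZMod 2) F (plane hγ j)

lemma orbitOf_plane_injective [Finite F] :
    Function.Injective fun j => orbitOf (ZMod 2) F (plane hγ j) := by
  intro j k h
  obtain ⟨α, hα, hW⟩ := (show orbitOf (ZMod 2) F (plane hγ j) = orbitOf (ZMod 2) F (plane hγ k)
    from h) ▸ mem_orbitOf_self (plane hγ j)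
  rw [← cyclicShift_one (plane hγ j)] at hW
  exact (eq_of_cyclicShift_plane_eq hγ one_ne_zero hα hW).1

lemma isCyclicCode_planeCode [Finite F] : IsCyclicCode (ZMod 2) F 3 4 (planeCode hγ) := by
  refine ⟨fun U hU => ?_, fun α hα U hU => ?_, fun U hU W hW hUW => ?_⟩
  · obtain ⟨j, β, hβ, rfl⟩ := Set.mem_iUnion.1 hU
    rw [finrank_cyclicShift hβ, finrank_plane]
  · obtain ⟨j, β, hβ, rfl⟩ := Set.mem_iUnion.1 hU
    exact Set.mem_iUnion.2 ⟨j, α * β, mul_ne_zero hα hβ, (cyclicShift_mul _ _ _).symm⟩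
  · obtain ⟨j, α, hα, rfl⟩ := Set.mem_iUnion.1 hU
    obtain ⟨k, β, hβ, rfl⟩ := Set.mem_iUnion.1 hW
    have hle : finrank (ZMod 2) ↥(cyclicShift (ZMod 2) F α (plane hγ j) ⊓
        cyclicShift (ZMod 2) F β (plane hγ k)) ≤ 1 := by
      by_contra! h
      obtain ⟨x, hx, y, hy, hx0, hy0, hxy⟩ := exists_pair_of_two_le_finrank h
      exact hUW
        (eq_of_mem_cyclicShift_plane hγ hα hβ hx0 hy0 hxy hx.1 hy.1 hx.2 hy.2).2.2
    rw [subspaceDist, finrank_cyclicShift hα, finrank_cyclicShift hβ, finrank_plane, finrank_plane]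
    omega

lemma ncard_planeCode [Finite F] (hF : Nat.card F = 512) : (planeCode hγ).ncard = 5694 := by
  rw [planeCode, Set.ncard_iUnion_of_finite (fun _ => Set.toFinite _), finsum_eq_sum_of_fintype,
    Fin.sum_univ_castSucc]
  · have h : ∀ i : Fin 11, (orbitOf (ZMod 2) F (plane hγ i.castSucc)).ncard = 511 := fun i =>
      ncard_orbitOf_plane hγ hF (Fin.castSucc_lt_last i).ne
    rw [Finset.sum_congr rfl fun i _ => h i]
    have := ncard_orbitOf_plane_last hγ hF
    simp only [show Fin.last 11 = 11 from rfl, this]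
    simp
  · intro j k hjk
    refine Set.disjoint_left.2 ?_
    rintro _ ⟨α, hα, rfl⟩ ⟨β, hβ, h⟩
    exact hjk (eq_of_cyclicShift_plane_eq hγ hα hβ h).1

lemma orbitsOf_planeCode :
    orbitsOf (ZMod 2) F (planeCode hγ) =
      Set.range fun j => orbitOf (ZMod 2) F (plane hγ j) := by
  ext O
  constructor
  · rintro ⟨V, hV, rfl⟩
    obtain ⟨j, α, hα, rfl⟩ := Set.mem_iUnion.1 hV
    exact ⟨j, (orbitOf_cyclicShift hα _).symm⟩
  · rintro ⟨j, rfl⟩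
    exact ⟨plane hγ j, Set.mem_iUnion.2 ⟨j, mem_orbitOf_self _⟩, rfl⟩

lemma ncard_orbitsOf_planeCode [Finite F] :
    (orbitsOf (ZMod 2) F (planeCode hγ)).ncard = 12 := by
  rw [orbitsOf_planeCode, ← Set.image_univ,
    Set.ncard_image_of_injective _ (orbitOf_plane_injective hγ), Set.ncard_univ, Nat.card_fin]

lemma sep_orbitsOf_planeCode (m : ℕ) :
    {O ∈ orbitsOf (ZMod 2) F (planeCode hγ) | O.ncard = m} =
      (fun j => orbitOf (ZMod 2) F (plane hγ j)) ''
        {j | (orbitOf (ZMod 2) F (plane hγ j)).ncard = m} := by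
  rw [orbitsOf_planeCode]
  ext O
  constructor
  · rintro ⟨⟨j, rfl⟩, h⟩
    exact ⟨j, h, rfl⟩
  · rintro ⟨j, h, rfl⟩
    exact ⟨⟨j, rfl⟩, h⟩

lemma ncard_full_orbits_planeCode [Finite F] (hF : Nat.card F = 512) :
    {O ∈ orbitsOf (ZMod 2) F (planeCode hγ) | O.ncard = 511}.ncard = 11 := by
  rw [sep_orbitsOf_planeCode, Set.ncard_image_of_injective _ (orbitOf_plane_injective hγ)]
  have : {j | (orbitOf (ZMod 2) F (plane hγ j)).ncard = 511} = ({11}ᶜ : Set (Fin 12)) := by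
    ext j
    by_cases hj : j = 11
    · subst hj
      simp [ncard_orbitOf_plane_last hγ hF]
    · simp [ncard_orbitOf_plane hγ hF hj, hj]
  rw [this]
  have := Set.ncard_add_ncard_compl ({11} : Set (Fin 12))
  rw [Set.ncard_singleton, Nat.card_fin] at this
  omega

lemma ncard_short_orbits_planeCode [Finite F] (hF : Nat.card F = 512) :
    {O ∈ orbitsOf (ZMod 2) F (planeCode hγ) | O.ncard = 73}.ncard = 1 := by
  rw [sep_orbitsOf_planeCode, Set.ncard_image_of_injective _ (orbitOf_plane_injective hγ)]
  have : {j | (orbitOf (ZMod 2) F (plane hγ j)).ncard = 73} = ({11} : Set (Fin 12)) := by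
    ext j
    by_cases hj : j = 11
    · subst hj
      simp [ncard_orbitOf_plane_last hγ hF]
    · simp [ncard_orbitOf_plane hγ hF hj, hj]
  rw [this, Set.ncard_singleton]

end Planes

section Lines

lemma eq_one_of_pow_three_eq_one {F : Type*} [Field F] [Finite F] (hF : Nat.card F = 512)
    {x : F} (hx : x ^ 3 = 1) : x = 1 := by
  have := Fintype.ofFinite F
  have h0 : x ≠ 0 := by
    rintro rfl
    simp at hx
  have h := FiniteField.pow_card_sub_one_eq_one x h0
  rw [← Nat.card_eq_fintype_card, hF, show 512 - 1 = 3 * 170 + 1 by norm_num, pow_succ, pow_mul, hx,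
    one_pow, one_mul] at h
  exact h

variable {F : Type*} [Field F] [Algebra (ZMod 2) F] [CharP F 2] [Finite F]

lemma mem_of_finrank_two {U : Submodule (ZMod 2) F} (hU : finrank (ZMod 2) U = 2) {u v w : F}
    (hu : u ∈ U) (hv : v ∈ U) (hw : w ∈ U) (hu0 : u ≠ 0) (hv0 : v ≠ 0) (huv : u ≠ v) :
    w = 0 ∨ w = u ∨ w = v ∨ w = u + v := by
  classical
  have hcard : (U : Set F).ncard = 4 := by
    rw [← Nat.card_coe_set_eq]
    change Nat.card U = 4
    rw [Module.natCard_eq_pow_finrank (K := ZMod 2), hU, Nat.card_zmod]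
    norm_num
  have huv0 : u + v ≠ 0 := fun h => huv (CharTwo.add_eq_zero.1 h)
  have h : ((({0, u, v, u + v} : Finset F)) : Set F) = U := by
    refine Set.eq_of_subset_of_ncard_le ?_ ?_
    · intro z hz
      simp only [Finset.coe_insert, Finset.coe_singleton, Set.mem_insert_iff,
        Set.mem_singleton_iff] at hz
      rcases hz with rfl | rfl | rfl | rfl
      exacts [U.zero_mem, hu, hv, U.add_mem hu hv]
    · rw [hcard, Set.ncard_coe_finset, Finset.card_insert_of_notMem, Finset.card_insert_of_notMem,
        Finset.card_pair]
      · simpa using hu0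
      · simp [huv, hv0]
      · simp [hu0.symm, hv0.symm, huv0.symm]
  have := h.ge hw
  simpa using this

lemma cyclicShift_div_ne_self (hF : Nat.card F = 512) {U : Submodule (ZMod 2) F}
    (hU : finrank (ZMod 2) U = 2) {u v : F} (hu : u ∈ U) (hv : v ∈ U) (hu0 : u ≠ 0) (hv0 : v ≠ 0)
    (huv : u ≠ v) : cyclicShift (ZMod 2) F (v / u) U ≠ U := by
  intro h
  have hne : v / u ≠ 1 := by rwa [Ne, div_eq_one_iff_eq hu0, eq_comm]
  have hw : v / u * v ∈ U := h ▸ mem_cyclicShift.2 ⟨v, hv, rfl⟩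
  obtain ⟨x, rfl⟩ : ∃ x, v = x * u := ⟨v / u, (div_mul_cancel₀ v hu0).symm⟩
  rw [mul_div_cancel_right₀ _ hu0] at hne hw
  have hx0 := left_ne_zero_of_mul hv0
  rcases mem_of_finrank_two hU hu hv hw hu0 hv0 huv with h | h | h | h
  · simp [hx0, hu0] at h
  · have h2 : (x + 1) ^ 2 = 0 := by
      rw [CharTwo.add_sq, one_pow, CharTwo.add_eq_zero]
      exact mul_right_cancel₀ hu0 (by linear_combination h)
    exact hne (CharTwo.add_eq_zero.1 (pow_eq_zero_iff two_ne_zero |>.1 h2))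
  · exact hne (mul_right_cancel₀ hv0 (by rw [h, one_mul]))
  · have h2 : x ^ 2 = 1 + x := mul_right_cancel₀ hu0 (by linear_combination h)
    have h20 : (2 : F) = 0 := CharTwo.two_eq_zero
    exact hne (eq_one_of_pow_three_eq_one hF (by linear_combination (x + 1) * h2 + x * h20))

lemma eq_empty_of_isCyclicCode_two_four (hF : Nat.card F = 512) {C : Set (Submodule (ZMod 2) F)}
    (hC : IsCyclicCode (ZMod 2) F 2 4 C) : C = ∅ := by
  obtain ⟨hdim, hshift, hdist⟩ := hC
  refine Set.eq_empty_of_forall_notMem fun U hU => ?_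
  obtain ⟨u, hu, v, hv, hu0, hv0, huv⟩ := exists_pair_of_two_le_finrank (hdim U hU).ge
  have hW := hshift (v / u) (div_ne_zero hv0 hu0) U hU
  have hd := hdist U hU _ hW (cyclicShift_div_ne_self hF (hdim U hU) hu hv hu0 hv0 huv).symm
  have hpos : 0 < finrank (ZMod 2) ↥(U ⊓ cyclicShift (ZMod 2) F (v / u) U) := by
    have : Nontrivial ↥(U ⊓ cyclicShift (ZMod 2) F (v / u) U) :=
      Submodule.nontrivial_iff_ne_bot.2 <| (Submodule.ne_bot_iff _).2
        ⟨v, ⟨hv, mem_cyclicShift.2 ⟨u, hu, div_mul_cancel₀ v hu0⟩⟩, hv0⟩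
    exact finrank_pos
  rw [subspaceDist, hdim U hU, hdim _ hW] at hd
  omega

end Lines

/-- there is a cyclic code in G_2(9,3) with minimum subspace distance at
least 4 and 5694 codewords, consisting of 11 orbits of cardinality 511 and one orbit of
cardinality 73 (hence 𝒞_2(9,4,3) ≥ 5694); moreover 𝒞_2(9,4,2) = 0: every cyclic code in
G_2(9,2) with minimum subspace distance at least 4 is empty. -/
theorem C2_9_results :
    (∃ C : Set (Submodule (ZMod 2) (GaloisField 2 9)),
      IsCyclicCode (ZMod 2) (GaloisField 2 9) 3 4 C ∧ C.ncard = 5694 ∧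
      {O ∈ orbitsOf (ZMod 2) (GaloisField 2 9) C | O.ncard = 511}.ncard = 11 ∧
      {O ∈ orbitsOf (ZMod 2) (GaloisField 2 9) C | O.ncard = 73}.ncard = 1 ∧
      (orbitsOf (ZMod 2) (GaloisField 2 9) C).ncard = 12) ∧
    (5694 ∈ {m : ℕ | ∃ C : Set (Submodule (ZMod 2) (GaloisField 2 9)),
      IsCyclicCode (ZMod 2) (GaloisField 2 9) 3 4 C ∧ C.ncard = m}) ∧
    (∀ C : Set (Submodule (ZMod 2) (GaloisField 2 9)),
      IsCyclicCode (ZMod 2) (GaloisField 2 9) 2 4 C → C = ∅) := by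
  obtain ⟨γ, hγ⟩ := exists_root
  have hF : Nat.card (GaloisField 2 9) = 512 := GaloisField.card 2 9 (by norm_num)
  have hC := isCyclicCode_planeCode hγ
  have hcard := ncard_planeCode hγ hF
  exact ⟨⟨planeCode hγ, hC, hcard, ncard_full_orbits_planeCode hγ hF,
    ncard_short_orbits_planeCode hγ hF, ncard_orbitsOf_planeCode hγ⟩,
    ⟨planeCode hγ, hC, hcard⟩, fun _ => eq_empty_of_isCyclicCode_two_four hF⟩
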